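/- Let m ≥ 1, let D ⊆ ℝ^m be a nonempty compact convex set, and let L : ℝ^m → ℝ be differentiable and convex. Suppose there is a constant C_l ≥ 0 such that for all f, g ∈ D and all λ ∈ [0,1], L(f + λ·(g − f)) ≤ L(f) + λ·⟪g − f, ∇L(f)⟫ + (λ²/2)·C_l (smooth empirical risk assumption). Let F* ∈ D be a minimizer of L over D, and let δ ≥ 0. Define approximate Frank–Wolfe iterates: F₀ ∈ D arbitrary, and for each t ≥ 0, choose h_t ∈ D satisfying the inexact oracle condition ⟪h_t, ∇L(F_t)⟫ ≤ min_{s∈D} ⟪s, ∇L(F_t)⟫ + (δ·γ_t·C_l)/2 where γ_t = 2/(t+2), and set F_{t+1} = (1 − γ_t)·F_t + γ_t·h_t. Then for every t ≥ 1, L(F_t) − L(F*) ≤ (2·C_l/(t + 2))·(1 + δ). -/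

import Mathlib

open scoped RealInnerProductSpace

/-- First-order characterization of convexity: a convex function lies above its tangent plane. -/
theorem ConvexOn.add_inner_le_of_hasGradientAt {E : Type*} [NormedAddCommGroup E]
    [InnerProductSpace ℝ E] [CompleteSpace E] {f : E → ℝ} {f' x : E}
    (hf : ConvexOn ℝ Set.univ f) (hx : HasGradientAt f f' x) (y : E) :
    f x + ⟪y - x, f'⟫ ≤ f y := by
  have hline : HasDerivAt (AffineMap.lineMap x y : ℝ → E) (y - x) 0 :=
    AffineMap.hasDerivAt_lineMap
  have hx0 : HasFDerivAt f (InnerProductSpace.toDual ℝ E f') (AffineMap.lineMap x y (0 : ℝ)) := by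
    simpa using hx.hasFDerivAt
  have hderiv := hx0.comp_hasDerivAt (0 : ℝ) hline
  have hcomp : ConvexOn ℝ Set.univ (f ∘ (AffineMap.lineMap x y : ℝ →ᵃ[ℝ] E)) := by
    simpa using hf.comp_affineMap (AffineMap.lineMap x y : ℝ →ᵃ[ℝ] E)
  have hslope := hcomp.le_slope_of_hasDerivAt (Set.mem_univ (0 : ℝ)) (Set.mem_univ 1)
    zero_lt_one hderiv
  simp only [InnerProductSpace.toDual_apply_apply, slope_def_field, Function.comp_apply,
    AffineMap.lineMap_apply_one, AffineMap.lineMap_apply_zero, sub_zero, div_one] at hslope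
  rw [real_inner_comm]
  linarith

/-- A sequence obeying the Frank–Wolfe recursion with step sizes `2 / (t + 2)` decays like
`2 * A / (t + 2)` from the first step on. -/
theorem le_two_mul_div_of_frankWolfe_recursion {a : ℕ → ℝ} {A : ℝ} (hA : 0 ≤ A)
    (ha : ∀ t : ℕ, a (t + 1) ≤
      (1 - 2 / ((t : ℝ) + 2)) * a t + (2 / ((t : ℝ) + 2)) ^ 2 / 2 * A)
    {t : ℕ} (ht : 1 ≤ t) : a t ≤ 2 * A / ((t : ℝ) + 2) := by
  induction t, ht using Nat.le_induction with
  | base =>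
    have h0 := ha 0
    norm_num at h0 ⊢
    linarith
  | succ t _ ih =>
    have hpos : (0 : ℝ) < t + 2 := by positivity
    have hstep : 0 ≤ 1 - 2 / ((t : ℝ) + 2) := by
      rw [sub_nonneg, div_le_one hpos]
      linarith [t.cast_nonneg (α := ℝ)]
    calc a (t + 1)
        ≤ (1 - 2 / ((t : ℝ) + 2)) * (2 * A / (t + 2)) + (2 / ((t : ℝ) + 2)) ^ 2 / 2 * A :=
          (ha t).trans (by gcongr)
      _ = 2 * A * (t + 1) / (t + 2) ^ 2 := by field_simp; ring
      _ ≤ 2 * A / (((t + 1 : ℕ) : ℝ) + 2) := by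
          push_cast
          rw [div_le_div_iff₀ (by positivity) (by positivity), mul_assoc (2 * A)]
          gcongr
          nlinarith

/-- Convergence of Frank–Wolfe boosting with an inexact linearized-subproblem oracle:
if `⟪h_t, ∇L(F_t)⟫ ≤ min_{s∈D} ⟪s, ∇L(F_t)⟫ + δ·γ_t·C_l/2` with `γ_t = 2/(t+2)`, then
`L(F_t) − L(F*) ≤ (2·C_l/(t+2))·(1+δ)` for all `t ≥ 1`. -/
theorem fw_boost_convergence_inexact (m : ℕ) (hm : 1 ≤ m)
    (D : Set (EuclideanSpace ℝ (Fin m))) (hDne : D.Nonempty)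
    (hDcpt : IsCompact D) (hDcvx : Convex ℝ D)
    (L : EuclideanSpace ℝ (Fin m) → ℝ)
    (grad : EuclideanSpace ℝ (Fin m) → EuclideanSpace ℝ (Fin m))
    (hgrad : ∀ z, HasGradientAt L (grad z) z)
    (hconv : ConvexOn ℝ Set.univ L)
    (Cl : ℝ) (hCl : 0 ≤ Cl)
    (hsmooth : ∀ f ∈ D, ∀ g ∈ D, ∀ lam ∈ Set.Icc (0 : ℝ) 1,
      L (f + lam • (g - f)) ≤ L f + lam * ⟪g - f, grad f⟫ + lam ^ 2 / 2 * Cl)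
    (Fstar : EuclideanSpace ℝ (Fin m)) (hFstar : Fstar ∈ D)
    (hmin : ∀ s ∈ D, L Fstar ≤ L s)
    (δ : ℝ) (hδ : 0 ≤ δ)
    (F h : ℕ → EuclideanSpace ℝ (Fin m)) (hF0 : F 0 ∈ D)
    (hhD : ∀ t, h t ∈ D)
    (horacle : ∀ t : ℕ, ∀ s ∈ D,
      ⟪h t, grad (F t)⟫ ≤ ⟪s, grad (F t)⟫ + δ * (2 / ((t : ℝ) + 2)) * Cl / 2)
    (hupd : ∀ t : ℕ, F (t + 1) =
      (1 - 2 / ((t : ℝ) + 2)) • F t + (2 / ((t : ℝ) + 2)) • h t) :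
    ∀ t : ℕ, 1 ≤ t → L (F t) - L Fstar ≤ 2 * Cl / ((t : ℝ) + 2) * (1 + δ) := by
  have hstep (t : ℕ) : 2 / ((t : ℝ) + 2) ∈ Set.Icc (0 : ℝ) 1 :=
    ⟨by positivity, by
      rw [div_le_one (by positivity)]
      linarith [t.cast_nonneg (α := ℝ)]⟩
  have hupd' (t : ℕ) : F (t + 1) = F t + (2 / ((t : ℝ) + 2)) • (h t - F t) := by
    rw [hupd]
    module
  have hFD (t : ℕ) : F t ∈ D := by
    induction t with
    | zero => exact hF0
    | succ t ih =>
      rw [hupd']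
      exact hDcvx.add_smul_sub_mem ih (hhD t) (hstep t)
  have hgap (t : ℕ) : L (F (t + 1)) - L Fstar ≤
      (1 - 2 / ((t : ℝ) + 2)) * (L (F t) - L Fstar) +
        (2 / ((t : ℝ) + 2)) ^ 2 / 2 * (Cl * (1 + δ)) := by
    have hdescent := hsmooth (F t) (hFD t) (h t) (hhD t) _ (hstep t)
    rw [← hupd' t] at hdescent
    have htangent := hconv.add_inner_le_of_hasGradientAt (hgrad (F t)) Fstar
    have hlin : ⟪h t - F t, grad (F t)⟫ ≤
        L Fstar - L (F t) + δ * (2 / ((t : ℝ) + 2)) * Cl / 2 := by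
      rw [inner_sub_left] at htangent ⊢
      linarith [horacle t Fstar hFstar]
    linarith [mul_le_mul_of_nonneg_left hlin (hstep t).1]
  intro t ht
  calc L (F t) - L Fstar ≤ 2 * (Cl * (1 + δ)) / ((t : ℝ) + 2) :=
        le_two_mul_div_of_frankWolfe_recursion (a := fun t ↦ L (F t) - L Fstar)
          (by positivity) hgap ht
    _ = 2 * Cl / ((t : ℝ) + 2) * (1 + δ) := by ring
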